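/- (a) For every (t,k) as above, every u ∈ B_0(t,k) and every v ∈ B_1(t,k) satisfy u < v componentwise. (b) For every function A : {1,…,n}^d → ℤ: max over all pairs i < j in {1,…,n}^d of (A(j) − A(i)) equals the maximum over all (t,k) of ( max_{v ∈ B_1(t,k)} A(v) − min_{u ∈ B_0(t,k)} A(u) ). -/

import Mathlib

/-- The left half `L(t,k)` of the dyadic interval `C(t,k)` of `{1,…,2^m}`. -/
def dyL (m t k : ℕ) : Set ℕ :=
  Set.Icc ((k - 1) * 2 ^ m / 2 ^ t + 1) ((2 * k - 1) * 2 ^ m / 2 ^ (t + 1))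

/-- The right half `R(t,k)` of the dyadic interval `C(t,k)` of `{1,…,2^m}`. -/
def dyR (m t k : ℕ) : Set ℕ :=
  Set.Icc ((2 * k - 1) * 2 ^ m / 2 ^ (t + 1) + 1) (k * 2 ^ m / 2 ^ t)

/-- Clearing the divisions in `dyL`. -/
lemma mem_dyL_iff {t e k x : ℕ} :
    x ∈ dyL (t + e + 1) t k ↔ (k - 1) * (2 * 2 ^ e) + 1 ≤ x ∧ x ≤ (2 * k - 1) * 2 ^ e := by
  have h₁ : (k - 1) * 2 ^ (t + e + 1) / 2 ^ t = (k - 1) * (2 * 2 ^ e) :=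
    Nat.div_eq_of_eq_mul_left (by positivity) (by ring)
  have h₂ : (2 * k - 1) * 2 ^ (t + e + 1) / 2 ^ (t + 1) = (2 * k - 1) * 2 ^ e :=
    Nat.div_eq_of_eq_mul_left (by positivity) (by ring)
  simp only [dyL, Set.mem_Icc, h₁, h₂]

/-- Clearing the divisions in `dyR`. -/
lemma mem_dyR_iff {t e k x : ℕ} :
    x ∈ dyR (t + e + 1) t k ↔ (2 * k - 1) * 2 ^ e + 1 ≤ x ∧ x ≤ k * (2 * 2 ^ e) := by
  have h₁ : k * 2 ^ (t + e + 1) / 2 ^ t = k * (2 * 2 ^ e) :=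
    Nat.div_eq_of_eq_mul_left (by positivity) (by ring)
  have h₂ : (2 * k - 1) * 2 ^ (t + e + 1) / 2 ^ (t + 1) = (2 * k - 1) * 2 ^ e :=
    Nat.div_eq_of_eq_mul_left (by positivity) (by ring)
  simp only [dyR, Set.mem_Icc, h₁, h₂]

lemma lt_of_mem_dyL_of_mem_dyR {m t k u v : ℕ} (hu : u ∈ dyL m t k) (hv : v ∈ dyR m t k) :
    u < v :=
  Nat.lt_of_lt_of_le (Nat.lt_succ_of_le hu.2) hv.1

lemma one_le_of_mem_dyL {m t k u : ℕ} (hu : u ∈ dyL m t k) : 1 ≤ u :=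
  (Nat.le_add_left _ _).trans hu.1

lemma le_two_pow_of_mem_dyR {m t k v : ℕ} (hk : k ≤ 2 ^ t) (hv : v ∈ dyR m t k) :
    v ≤ 2 ^ m :=
  hv.2.trans (Nat.div_le_of_le_mul (Nat.mul_le_mul_right _ hk))

lemma dyL_nonempty {m t k : ℕ} (hm : 1 ≤ m) (ht : t ≤ m - 1) (hk : 1 ≤ k) :
    (dyL m t k).Nonempty := by
  obtain ⟨e, rfl⟩ : ∃ e, m = t + e + 1 := ⟨m - 1 - t, by omega⟩
  obtain ⟨c, rfl⟩ : ∃ c, k = c + 1 := ⟨k - 1, by omega⟩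
  have he : 0 < 2 ^ e := by positivity
  refine ⟨_, mem_dyL_iff.2 ⟨le_rfl, ?_⟩⟩
  rw [show 2 * (c + 1) - 1 = 2 * c + 1 by omega, Nat.add_sub_cancel]
  nlinarith

lemma dyR_nonempty {m t k : ℕ} (hm : 1 ≤ m) (ht : t ≤ m - 1) (hk : 1 ≤ k) :
    (dyR m t k).Nonempty := by
  obtain ⟨e, rfl⟩ : ∃ e, m = t + e + 1 := ⟨m - 1 - t, by omega⟩
  obtain ⟨c, rfl⟩ : ∃ c, k = c + 1 := ⟨k - 1, by omega⟩
  have he : 0 < 2 ^ e := by positivity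
  refine ⟨_, mem_dyR_iff.2 ⟨le_rfl, ?_⟩⟩
  rw [show 2 * (c + 1) - 1 = 2 * c + 1 by omega]
  nlinarith

/-- Two distinct numbers below `2 ^ m` are separated by the midpoint of a dyadic interval. -/
lemma exists_dyadic_separation {m a b : ℕ} (hab : a < b) (hb : b < 2 ^ m) :
    ∃ t e c, m = t + e + 1 ∧ c < 2 ^ t ∧ c * (2 * 2 ^ e) ≤ a ∧ a < (2 * c + 1) * 2 ^ e ∧
      (2 * c + 1) * 2 ^ e ≤ b ∧ b < (c + 1) * (2 * 2 ^ e) := by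
  induction m generalizing a b with
  | zero => simp at hb; omega
  | succ m ih =>
    rw [pow_succ] at hb
    rcases lt_or_ge b (2 ^ m) with hbm | hbm
    · obtain ⟨t, e, c, rfl, hc, h⟩ := ih hab hbm
      exact ⟨t + 1, e, c, by ring, by rw [pow_succ]; omega, h⟩
    rcases lt_or_ge a (2 ^ m) with ham | ham
    · exact ⟨0, m, 0, by ring, by simp, by simp, by simpa, by simpa, by omega⟩
    · obtain ⟨t, e, c, rfl, hc, h₁, h₂, h₃, h₄⟩ :=
        ih (a := a - 2 ^ m) (b := b - 2 ^ m) (by omega) (by omega)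
      have hp : 2 ^ (t + e + 1) = 2 ^ t * (2 * 2 ^ e) := by ring
      refine ⟨t + 1, e, c + 2 ^ t, by ring, by rw [pow_succ]; omega, ?_, ?_, ?_, ?_⟩
      · rw [add_mul]; omega
      · rw [show (2 * (c + 2 ^ t) + 1) * 2 ^ e
          = (2 * c + 1) * 2 ^ e + 2 ^ t * (2 * 2 ^ e) by ring]; omega
      · rw [show (2 * (c + 2 ^ t) + 1) * 2 ^ e
          = (2 * c + 1) * 2 ^ e + 2 ^ t * (2 * 2 ^ e) by ring]; omega
      · rw [show (c + 2 ^ t + 1) * (2 * 2 ^ e)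
          = (c + 1) * (2 * 2 ^ e) + 2 ^ t * (2 * 2 ^ e) by ring]; omega

lemma exists_mem_dyL_mem_dyR {m i j : ℕ} (hi : 1 ≤ i) (hij : i < j) (hj : j ≤ 2 ^ m) :
    ∃ t k, t ≤ m - 1 ∧ (1 ≤ k ∧ k ≤ 2 ^ t) ∧ i ∈ dyL m t k ∧ j ∈ dyR m t k := by
  obtain ⟨t, e, c, rfl, hc, h₁, h₂, h₃, h₄⟩ :=
    exists_dyadic_separation (m := m) (a := i - 1) (b := j - 1) (by omega) (by omega)
  refine ⟨t, c + 1, by omega, by omega, mem_dyL_iff.2 ?_, mem_dyR_iff.2 ?_⟩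
  · rw [show 2 * (c + 1) - 1 = 2 * c + 1 by omega, Nat.add_sub_cancel]
    omega
  · rw [show 2 * (c + 1) - 1 = 2 * c + 1 by omega]
    omega

lemma finite_box_image {d : ℕ} (A : (Fin d → ℕ) → ℤ) (S : Fin d → Set ℕ)
    (hS : ∀ s, (S s).Finite) : (A '' {v | ∀ s, v s ∈ S s}).Finite :=
  (Set.Finite.pi' hS).image A

lemma box_image_nonempty {d : ℕ} (A : (Fin d → ℕ) → ℤ) (S : Fin d → Set ℕ)
    (hS : ∀ s, (S s).Nonempty) : (A '' {v | ∀ s, v s ∈ S s}).Nonempty := by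
  choose v hv using hS
  exact ⟨A v, v, hv, rfl⟩

/-- (a) For every valid `(t,k)`, every `u ∈ B_0(t,k)` and
`v ∈ B_1(t,k)` satisfy `u < v` componentwise.  (b) For every
`A : {1,…,n}^d → ℤ`, `max_{i < j} (A(j) − A(i))` equals the maximum over all
`(t,k)` of `max_{v ∈ B_1(t,k)} A(v) − min_{u ∈ B_0(t,k)} A(u)`. -/
theorem stmt11 (m d : ℕ) (hm : 1 ≤ m) (hd : 1 ≤ d) (A : (Fin d → ℕ) → ℤ) :
    (∀ t k : Fin d → ℕ, (∀ s, t s ≤ m - 1) → (∀ s, 1 ≤ k s ∧ k s ≤ 2 ^ t s) →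
      ∀ u v : Fin d → ℕ, (∀ s, u s ∈ dyL m (t s) (k s)) →
        (∀ s, v s ∈ dyR m (t s) (k s)) → ∀ s, u s < v s) ∧
    sSup {z : ℤ | ∃ i j : Fin d → ℕ,
        (∀ s, 1 ≤ i s ∧ i s ≤ 2 ^ m) ∧ (∀ s, 1 ≤ j s ∧ j s ≤ 2 ^ m) ∧
        (∀ s, i s < j s) ∧ z = A j - A i} =
      sSup {z : ℤ | ∃ t k : Fin d → ℕ,
        (∀ s, t s ≤ m - 1) ∧ (∀ s, 1 ≤ k s ∧ k s ≤ 2 ^ t s) ∧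
        z = sSup (A '' {v | ∀ s, v s ∈ dyR m (t s) (k s)}) -
            sInf (A '' {u | ∀ s, u s ∈ dyL m (t s) (k s)})} := by
  refine ⟨fun t k _ _ u v hu hv s => lt_of_mem_dyL_of_mem_dyR (hu s) (hv s), ?_⟩
  set P := {z : ℤ | ∃ i j : Fin d → ℕ,
    (∀ s, 1 ≤ i s ∧ i s ≤ 2 ^ m) ∧ (∀ s, 1 ≤ j s ∧ j s ≤ 2 ^ m) ∧
    (∀ s, i s < j s) ∧ z = A j - A i} with hP
  set Q := {z : ℤ | ∃ t k : Fin d → ℕ,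
    (∀ s, t s ≤ m - 1) ∧ (∀ s, 1 ≤ k s ∧ k s ≤ 2 ^ t s) ∧
    z = sSup (A '' {v | ∀ s, v s ∈ dyR m (t s) (k s)}) -
      sInf (A '' {u | ∀ s, u s ∈ dyL m (t s) (k s)})} with hQ
  have hfinR (t k : Fin d → ℕ) : (A '' {v | ∀ s, v s ∈ dyR m (t s) (k s)}).Finite :=
    finite_box_image A (fun s => dyR m (t s) (k s)) fun s => Set.finite_Icc _ _
  have hfinL (t k : Fin d → ℕ) : (A '' {u | ∀ s, u s ∈ dyL m (t s) (k s)}).Finite :=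
    finite_box_image A (fun s => dyL m (t s) (k s)) fun s => Set.finite_Icc _ _
  have hPbdd : BddAbove P := by
    have hfin : (A '' {v | ∀ s, v s ∈ Set.Icc 1 (2 ^ m)}).Finite :=
      finite_box_image A (fun _ => Set.Icc 1 (2 ^ m)) fun _ => Set.finite_Icc _ _
    refine ((hfin.prod hfin).image fun p => p.1 - p.2).bddAbove.mono ?_
    rintro z ⟨i, j, hi, hj, -, rfl⟩
    exact ⟨(A j, A i), ⟨⟨j, hj, rfl⟩, ⟨i, hi, rfl⟩⟩, rfl⟩
  have hQP : Q ⊆ P := by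
    rintro z ⟨t, k, ht, hk, rfl⟩
    obtain ⟨v, hv, hvA⟩ := Int.csSup_mem
      (box_image_nonempty A (fun s => dyR m (t s) (k s)) fun s =>
        dyR_nonempty hm (ht s) (hk s).1) (hfinR t k).bddAbove
    obtain ⟨u, hu, huA⟩ := Int.csInf_mem
      (box_image_nonempty A (fun s => dyL m (t s) (k s)) fun s =>
        dyL_nonempty hm (ht s) (hk s).1) (hfinL t k).bddBelow
    have huv (s) : u s < v s := lt_of_mem_dyL_of_mem_dyR (hu s) (hv s)
    have hu₁ (s) : 1 ≤ u s := one_le_of_mem_dyL (hu s)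
    have hv₁ (s) : v s ≤ 2 ^ m := le_two_pow_of_mem_dyR (hk s).2 (hv s)
    exact ⟨u, v, fun s => ⟨hu₁ s, (huv s).le.trans (hv₁ s)⟩,
      fun s => ⟨(hu₁ s).trans (huv s).le, hv₁ s⟩, huv, by rw [hvA, huA]⟩
  have hPQ : ∀ z ∈ P, ∃ w ∈ Q, z ≤ w := by
    rintro z ⟨i, j, hi, hj, hij, rfl⟩
    choose t k ht hk hiL hjR using fun s =>
      exists_mem_dyL_mem_dyR (hi s).1 (hij s) (hj s).2
    exact ⟨_, ⟨t, k, ht, hk, rfl⟩, sub_le_sub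
      (le_csSup (hfinR t k).bddAbove ⟨j, hjR, rfl⟩)
      (csInf_le (hfinL t k).bddBelow ⟨i, hiL, rfl⟩)⟩
  have hQne : Q.Nonempty := ⟨_, fun _ => 0, fun _ => 1, by simp, by simp, rfl⟩
  refine le_antisymm (csSup_le (hQne.mono hQP) fun z hz => ?_) (csSup_le_csSup hPbdd hQne hQP)
  obtain ⟨w, hw, hzw⟩ := hPQ z hz
  exact hzw.trans (le_csSup (hPbdd.mono hQP) hw)
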